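/- Let I ⊆ ℝ be an open interval and γ : ℝ × I → ℝ² a smooth map with γ(u+1,t) = γ(u,t) and ∂_uγ(u,t) ≠ 0 for all (u,t), and with γ(·,t) injective on [0,1) for each t ∈ I (a smooth family of embedded closed curves). Set T̂ = ∂_uγ/|∂_uγ|, h = |∂_uγ|⁻¹·∂_uT̂ (the curvature vector), and v = ∂_tγ − ⟨∂_tγ, T̂⟩·T̂ (the normal velocity). Let w : ℝ × I → ℝ² be smooth with w(u+1,t) = w(u,t) and ⟨w(u,t), T̂(u,t)⟩ = 0 for all (u,t). Suppose that for every nonnegative C¹ function φ : ℝ² × I → ℝ such that φ(·,t) has compact support for each t, and for all t₁ < t₂ in I: ∫₀¹ φ(γ(u,t₂),t₂)|∂_uγ(u,t₂)| du − ∫₀¹ φ(γ(u,t₁),t₁)|∂_uγ(u,t₁)| du ≤ ∫_{t₁}^{t₂} ∫₀¹ [ ∂_tφ(γ(u,t),t) + (∇φ(γ(u,t),t) − φ(γ(u,t),t)·h(u,t))·w(u,t) ]·|∂_uγ(u,t)| du dt. Then w(u,t) = v(u,t) for all (u,t) ∈ ℝ × I. -/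

import Mathlib

open scoped RealInnerProductSpace

/-- Spatial (parameter) derivative `∂_uγ` of a moving curve `γ`. -/
noncomputable def du (γ : ℝ → ℝ → EuclideanSpace ℝ (Fin 2)) (u t : ℝ) :
    EuclideanSpace ℝ (Fin 2) :=
  deriv (fun u' => γ u' t) u

/-- Time derivative `∂_tγ` of a moving curve `γ`. -/
noncomputable def dtγ (γ : ℝ → ℝ → EuclideanSpace ℝ (Fin 2)) (u t : ℝ) :
    EuclideanSpace ℝ (Fin 2) :=
  deriv (fun t' => γ u t') t

/-- Unit tangent vector `T̂ = ∂_uγ/|∂_uγ|`. -/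
noncomputable def tang (γ : ℝ → ℝ → EuclideanSpace ℝ (Fin 2)) (u t : ℝ) :
    EuclideanSpace ℝ (Fin 2) :=
  ‖du γ u t‖⁻¹ • du γ u t

/-- Curvature vector `h = |∂_uγ|⁻¹ ∂_u T̂`. -/
noncomputable def curv (γ : ℝ → ℝ → EuclideanSpace ℝ (Fin 2)) (u t : ℝ) :
    EuclideanSpace ℝ (Fin 2) :=
  ‖du γ u t‖⁻¹ • deriv (fun u' => tang γ u' t) u

/-- Normal velocity `v = ∂_tγ − ⟨∂_tγ, T̂⟩ T̂`. -/
noncomputable def nvel (γ : ℝ → ℝ → EuclideanSpace ℝ (Fin 2)) (u t : ℝ) :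
    EuclideanSpace ℝ (Fin 2) :=
  dtγ γ u t - ⟪dtγ γ u t, tang γ u t⟫ • tang γ u t

abbrev E2 : Type := EuclideanSpace ℝ (Fin 2)

/-- The square of the positive part. -/
noncomputable def sqPos (s : ℝ) : ℝ := (max 0 s) ^ 2

lemma sqPos_hasDerivAt (s : ℝ) : HasDerivAt sqPos (2 * max 0 s) s := by
  rcases lt_trichotomy s 0 with h | h | h
  · have : sqPos =ᶠ[nhds s] fun _ => 0 := by
      filter_upwards [Iio_mem_nhds h] with x hx
      simp [sqPos, max_eq_left (le_of_lt (Set.mem_Iio.1 hx))]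
    rw [max_eq_left h.le, mul_zero]
    exact (hasDerivAt_const s (0:ℝ)).congr_of_eventuallyEq this
  · subst h
    rw [hasDerivAt_iff_isLittleO_nhds_zero]
    have h1 : (fun h : ℝ => h ^ 2) =o[nhds 0] fun h => h := by
      simpa using Asymptotics.isLittleO_pow_pow (𝕜 := ℝ) (m := 1) (n := 2) (by norm_num)
    refine Asymptotics.IsBigO.trans_isLittleO ?_ h1
    refine Asymptotics.IsBigO.of_bound 1 (Filter.Eventually.of_forall fun x => ?_)
    simp only [sqPos, zero_add, max_self, Real.norm_eq_abs, one_mul]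
    rcases le_total 0 x with hx | hx <;> simp [hx]
    positivity
  · have : sqPos =ᶠ[nhds s] fun x => x ^ 2 := by
      filter_upwards [Ioi_mem_nhds h] with x hx
      simp [sqPos, max_eq_right (le_of_lt (Set.mem_Ioi.1 hx))]
    rw [max_eq_right h.le]
    simpa using (hasDerivAt_pow 2 s).congr_of_eventuallyEq this

lemma sqPos_contDiff : ContDiff ℝ 1 sqPos := by
  rw [contDiff_one_iff_deriv]
  refine ⟨fun s => (sqPos_hasDerivAt s).differentiableAt, ?_⟩
  have : deriv sqPos = fun s => 2 * max 0 s := funext fun s => (sqPos_hasDerivAt s).deriv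
  rw [this]; fun_prop

lemma quad_bound_local (f : ℝ → ℝ) (hf : ContDiff ℝ 2 f) (a : ℝ) (h0 : f a = 0)
    (h1 : deriv f a = 0) : ∃ C : ℝ, 0 ≤ C ∧ ∀ᶠ u in nhds a, |f u| ≤ C * (u - a) ^ 2 := by
  have hd : ContDiff ℝ 1 (deriv f) := by
    have := (contDiff_succ_iff_deriv (n := 1) (f := f) (𝕜 := ℝ)).1 (by simpa [one_add_one_eq_two] using hf)
    exact this.2.2
  have hda := ((hd.differentiable (by norm_num)) a).hasDerivAt.isBigO_sub
  obtain ⟨C, hC, hb⟩ := hda.exists_pos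
  have hb := hb.bound
  rw [Metric.eventually_nhds_iff] at hb
  obtain ⟨ε, hε, hb⟩ := hb
  refine ⟨C, hC.le, ?_⟩
  rw [Metric.eventually_nhds_iff]
  refine ⟨ε, hε, fun u hu => ?_⟩
  have := (convex_closedBall a (dist u a)).norm_image_sub_le_of_norm_deriv_le (f := f)
    (C := C * |u - a|) (fun x _ => (hf.differentiable (by norm_num)) x) (fun x hx => by
      have hx' : dist x a ≤ dist u a := hx
      have := hb (lt_of_le_of_lt hx' hu)
      rw [h1, sub_zero] at this
      refine this.trans ?_
      rw [Real.dist_eq, Real.dist_eq] at hx'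
      rw [Real.norm_eq_abs]
      gcongr) (Metric.mem_closedBall_self dist_nonneg) (show u ∈ _ from le_refl (dist u a))
  rw [h0, sub_zero, Real.norm_eq_abs, Real.norm_eq_abs] at this
  rw [← sq_abs (u - a)]; nlinarith

lemma lower_bound_local (c : ℝ → E2) (hc : ContDiff ℝ 2 c) (a : ℝ)
    (h1 : deriv c a ≠ 0) : ∃ m : ℝ, 0 < m ∧ ∀ᶠ u in nhds a, m * (u - a) ^ 2 ≤ ‖c u - c a‖ ^ 2 := by
  have hp : 0 < ‖deriv c a‖ := norm_pos_iff.2 h1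
  have hd := ((hc.differentiable (by norm_num)) a).hasDerivAt
  rw [hasDerivAt_iff_isLittleO] at hd
  have hb := hd.def (half_pos hp)
  refine ⟨(‖deriv c a‖ / 2) ^ 2, by positivity, ?_⟩
  filter_upwards [hb] with u hu
  have h2 : ‖(u - a) • deriv c a‖ ≤ ‖c u - c a‖ + ‖c u - c a - (u - a) • deriv c a‖ := by
    have := norm_sub_le (c u - c a) (c u - c a - (u - a) • deriv c a)
    simpa using this
  rw [norm_smul] at h2
  rw [Real.norm_eq_abs] at h2 hu
  have h3 : ‖deriv c a‖ / 2 * |u - a| ≤ ‖c u - c a‖ := by linarith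
  rw [← sq_abs (u - a), ← mul_pow]
  gcongr

/-- On a closed embedded curve, the linear function `⟨x - x₀, d⟩` with `d` normal at `x₀` is
dominated by a multiple of the square distance. -/
lemma exists_quad_bound (c : ℝ → E2) (hc : ContDiff ℝ 2 c) (d x₀ : E2)
    (h : ∀ u ∈ Set.Icc (0:ℝ) 1, c u = x₀ → deriv c u ≠ 0 ∧ ⟪deriv c u, d⟫ = 0) :
    ∃ K : ℝ, 0 ≤ K ∧ ∀ u ∈ Set.Icc (0:ℝ) 1, |⟪c u - x₀, d⟫| ≤ K * ‖c u - x₀‖ ^ 2 := by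
  refine isCompact_Icc.induction_on
    (p := fun s => ∃ K : ℝ, 0 ≤ K ∧ ∀ u ∈ s, |⟪c u - x₀, d⟫| ≤ K * ‖c u - x₀‖ ^ 2)
    ⟨0, le_rfl, by simp⟩ ?_ ?_ ?_
  · rintro s t hst ⟨K, hK, hb⟩
    exact ⟨K, hK, fun u hu => hb u (hst hu)⟩
  · rintro s t ⟨K, hK, hb⟩ ⟨K', hK', hb'⟩
    refine ⟨K + K', by positivity, ?_⟩
    rintro u (hu | hu)
    · have := hb u hu
      nlinarith [sq_nonneg ‖c u - x₀‖]
    · have := hb' u hu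
      nlinarith [sq_nonneg ‖c u - x₀‖]
  · intro a ha
    by_cases hx : c a = x₀
    · obtain ⟨h1, h2⟩ := h a ha hx
      obtain ⟨m, hm, hlow⟩ := lower_bound_local c hc a h1
      have hcd : ∀ u, HasDerivAt c (deriv c u) u :=
        fun u => ((hc.differentiable (by norm_num)) u).hasDerivAt
      obtain ⟨C, hC, hup⟩ := quad_bound_local (fun u => ⟪c u - x₀, d⟫)
        ((hc.sub contDiff_const).inner ℝ contDiff_const) a (by simp [hx]) (by
          have := ((hcd a).sub_const x₀).inner ℝ (hasDerivAt_const a d)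
          rw [this.deriv]; simp [h2])
      refine ⟨{u | |⟪c u - x₀, d⟫| ≤ C / m * ‖c u - x₀‖ ^ 2}, mem_nhdsWithin_of_mem_nhds ?_,
        C / m, by positivity, fun u hu => hu⟩
      filter_upwards [hlow, hup] with u h3 h4
      rw [hx] at h3
      refine h4.trans ?_
      rw [div_mul_eq_mul_div, le_div_iff₀ hm]
      nlinarith
    · have hp : 0 < ‖c a - x₀‖ := norm_pos_iff.2 (sub_ne_zero.2 hx)
      have hev : ∀ᶠ u in nhds a, ‖c a - x₀‖ / 2 < ‖c u - x₀‖ :=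
        (((hc.continuous.sub continuous_const).norm).tendsto a).eventually
          (lt_mem_nhds (half_lt_self hp))
      refine ⟨{u | ‖c a - x₀‖ / 2 < ‖c u - x₀‖}, mem_nhdsWithin_of_mem_nhds hev,
        ‖d‖ / (‖c a - x₀‖ / 2), by positivity, fun u hu => ?_⟩
      have hu : ‖c a - x₀‖ / 2 < ‖c u - x₀‖ := hu
      refine (abs_real_inner_le_norm _ _).trans ?_
      rw [div_mul_eq_mul_div, le_div_iff₀ (by positivity)]
      have : 0 ≤ ‖c u - x₀‖ * ‖d‖ := by positivity
      nlinarith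

lemma static_core (c D : ℝ → E2) (B : ℝ → ℝ) (hc : ContDiff ℝ 2 c) (hD : Continuous D)
    (hB : Continuous B) (hc1 : c 1 = c 0) (hc1' : deriv c 1 = deriv c 0) (hD1 : D 1 = D 0)
    (hreg : ∀ u, deriv c u ≠ 0) (hinj : Set.InjOn c (Set.Ico (0:ℝ) 1))
    (hperp : ∀ u, ⟪deriv c u, D u⟫ = 0)
    (hint : ∀ φ : E2 → ℝ, ContDiff ℝ 1 φ → (∀ x, 0 ≤ φ x) → HasCompactSupport φ →
      0 ≤ ∫ u in (0:ℝ)..1, (fderiv ℝ φ (c u) (D u) * ‖deriv c u‖ + φ (c u) * B u)) :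
    ∀ u₀ ∈ Set.Ico (0:ℝ) 1, D u₀ = 0 := by
  intro u₀ hu₀
  by_contra hne
  set d := D u₀ with hd
  set x₀ := c u₀ with hx₀
  have hdpos : 0 < ‖d‖ := norm_pos_iff.2 hne
  have hcd : Continuous (deriv c) := hc.continuous_deriv (by norm_num)
  -- points of the curve at x₀
  have hpt : ∀ u ∈ Set.Icc (0:ℝ) 1, c u = x₀ → D u = d ∧ deriv c u = deriv c u₀ := by
    intro u hu hcu
    rcases lt_or_eq_of_le hu.2 with h | h
    · have : u = u₀ := hinj ⟨hu.1, h⟩ hu₀ hcu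
      rw [this]; exact ⟨rfl, rfl⟩
    · subst h
      rw [hc1] at hcu
      have : (0:ℝ) = u₀ := hinj ⟨le_rfl, zero_lt_one⟩ hu₀ hcu
      rw [hD1, hc1', hd, ← this]; exact ⟨rfl, rfl⟩
  obtain ⟨K, hK, hKb⟩ := exists_quad_bound c hc d x₀ (fun u hu hcu => ⟨hreg u, by
    have := hpt u hu hcu
    rw [this.2]; exact hperp u₀⟩)
  set L := K + 1 with hL
  -- the positive quantity
  set F : ℝ → ℝ := fun u => (⟪D u, d⟫ + 2 * L * ⟪c u - x₀, D u⟫) * ‖deriv c u‖ with hF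
  have hFc : Continuous F := by
    have := hc.continuous
    fun_prop
  set m := ‖d‖ ^ 2 * ‖deriv c u₀‖ / 2 with hm
  have hmpos : 0 < m := by
    have := norm_pos_iff.2 (hreg u₀)
    positivity
  have hFpt : ∀ u ∈ Set.Icc (0:ℝ) 1, c u = x₀ → m < F u := by
    intro u hu hcu
    obtain ⟨h1, h2⟩ := hpt u hu hcu
    have : F u = 2 * m := by
      simp only [hF, h1, h2, hcu, sub_self, inner_zero_left, real_inner_self_eq_norm_sq, hm]
      ring
    linarith
  obtain ⟨δ₁, hδ₁, hFδ⟩ : ∃ δ > 0, ∀ u ∈ Set.Icc (0:ℝ) 1, ‖c u - x₀‖ ^ 2 < δ → m < F u := by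
    have hcomp : IsCompact (Set.Icc (0:ℝ) 1 ∩ {u | F u ≤ m}) :=
      isCompact_Icc.inter_right (isClosed_le hFc continuous_const)
    rcases (Set.Icc (0:ℝ) 1 ∩ {u | F u ≤ m}).eq_empty_or_nonempty with he | hn
    · refine ⟨1, one_pos, fun u hu _ => ?_⟩
      by_contra hcon
      have : u ∈ (Set.Icc (0:ℝ) 1 ∩ {u | F u ≤ m}) := ⟨hu, not_lt.1 hcon⟩
      rw [he] at this; exact this
    · obtain ⟨a, ha, hmin⟩ := hcomp.exists_isMinOn hn
        (f := fun u => ‖c u - x₀‖ ^ 2)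
        (((hc.continuous.sub continuous_const).norm.pow 2).continuousOn)
      refine ⟨‖c a - x₀‖ ^ 2, ?_, fun u hu hlt => ?_⟩
      · have : c a - x₀ ≠ 0 := by
          intro h0
          exact absurd (hFpt a ha.1 (sub_eq_zero.1 h0)) (not_lt.2 ha.2)
        have := norm_pos_iff.2 this
        positivity
      · by_contra hcon
        exact absurd (hmin (show u ∈ _ from ⟨hu, not_lt.1 hcon⟩)) (not_le.2 hlt)
  obtain ⟨C, hC⟩ := (isCompact_Icc (a := (0:ℝ)) (b := 1)).exists_bound_of_continuousOn
    hB.continuousOn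
  have hCnn : 0 ≤ C := (norm_nonneg _).trans (hC 0 ⟨le_rfl, zero_le_one⟩)
  set δ := min δ₁ (m / (C + 1)) with hδ
  have hδpos : 0 < δ := lt_min hδ₁ (by positivity)
  have hδC : δ * C ≤ m := by
    have h1 : δ ≤ m / (C + 1) := min_le_right _ _
    rw [le_div_iff₀ (by positivity)] at h1
    nlinarith
  set g : E2 → ℝ := fun x => ⟪x - x₀, d⟫ + L * ‖x - x₀‖ ^ 2 with hg
  have hgc : ContDiff ℝ 1 g := by
    have h1 : ContDiff ℝ 1 (fun x : E2 => x - x₀) := contDiff_id.sub contDiff_const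
    exact (h1.inner ℝ contDiff_const).add (contDiff_const.mul (h1.norm_sq ℝ))
  have hgd : ∀ x y, fderiv ℝ g x y = ⟪y, d⟫ + 2 * L * ⟪x - x₀, y⟫ := by
    intro x y
    have h1 : HasFDerivAt (fun x : E2 => x - x₀) (ContinuousLinearMap.id ℝ E2) x :=
      (hasFDerivAt_id x).sub_const x₀
    have h2 := (h1.inner ℝ (hasFDerivAt_const d x)).add ((h1.norm_sq).const_mul L)
    have h3 : fderiv ℝ g x = _ := h2.fderiv
    rw [h3]
    simp [inner_sub_left]
    ring
  set φ : E2 → ℝ := fun x => sqPos (δ - g x) with hφ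
  have hφc : ContDiff ℝ 1 φ := sqPos_contDiff.comp (contDiff_const.sub hgc)
  have hφd : ∀ x y, fderiv ℝ φ x y =
      - (2 * max 0 (δ - g x)) * (⟪y, d⟫ + 2 * L * ⟪x - x₀, y⟫) := by
    intro x y
    have h1 : HasFDerivAt (fun x => δ - g x) (- fderiv ℝ g x) x :=
      ((hgc.differentiable (by norm_num)) x).hasFDerivAt.const_sub δ
    have h2 := (sqPos_hasDerivAt (δ - g x)).comp_hasFDerivAt x h1
    have h3 : fderiv ℝ φ x = _ := h2.fderiv
    rw [h3]
    simp [hgd]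
  have hφs : HasCompactSupport φ := by
    refine HasCompactSupport.intro (isCompact_closedBall x₀ (‖d‖ + δ + 1)) fun x hx => ?_
    have hx : ‖d‖ + δ + 1 < ‖x - x₀‖ := by
      rw [← dist_eq_norm]; simpa using hx
    have h1 : -(‖x - x₀‖ * ‖d‖) ≤ ⟪x - x₀, d⟫ :=
      (abs_le.1 (abs_real_inner_le_norm _ _)).1
    have : δ - g x ≤ 0 := by
      simp only [hg, hL]
      nlinarith [norm_nonneg (x - x₀), sq_nonneg ‖x - x₀‖, mul_nonneg hK (sq_nonneg ‖x - x₀‖)]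
    simp [hφ, sqPos, max_eq_left this]
  have key := hint φ hφc (fun x => by simp only [hφ, sqPos]; positivity) hφs
  have hgcurve : ∀ u ∈ Set.Icc (0:ℝ) 1, ‖c u - x₀‖ ^ 2 ≤ g (c u) := by
    intro u hu
    have h1 := (abs_le.1 (hKb u hu)).1
    simp only [hg, hL]
    linarith
  set J : ℝ → ℝ := fun u => fderiv ℝ φ (c u) (D u) * ‖deriv c u‖ + φ (c u) * B u with hJ
  have hJeq : ∀ u, J u = max 0 (δ - g (c u)) * (-2 * F u + max 0 (δ - g (c u)) * B u) := by
    intro u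
    simp only [hJ, hφd, hF]
    simp only [hφ, sqPos]
    ring
  have hJc : Continuous J := by
    have : J = fun u => max 0 (δ - g (c u)) * (-2 * F u + max 0 (δ - g (c u)) * B u) :=
      funext hJeq
    rw [this]
    have := hgc.continuous
    have := hc.continuous
    fun_prop
  have hJle : ∀ u ∈ Set.Icc (0:ℝ) 1, J u ≤ - (max 0 (δ - g (c u)) * m) := by
    intro u hu
    rw [hJeq]
    rcases le_total (δ - g (c u)) 0 with h | h
    · simp [max_eq_left h]
    · rw [max_eq_right h]
      rcases h.eq_or_lt with h | h
      · simp [← h]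
      have h1 := hgcurve u hu
      have h2 : m < F u := hFδ u hu (by
        have : δ ≤ δ₁ := min_le_left _ _
        linarith)
      have h3 := hC u hu
      rw [Real.norm_eq_abs] at h3
      have h4 : (δ - g (c u)) * B u ≤ m := by
        have h5 : (δ - g (c u)) * B u ≤ (δ - g (c u)) * C :=
          mul_le_mul_of_nonneg_left ((le_abs_self _).trans h3) h.le
        have h6 : (δ - g (c u)) * C ≤ δ * C := by
          apply mul_le_mul_of_nonneg_right _ hCnn
          nlinarith [sq_nonneg ‖c u - x₀‖]
        linarith
      nlinarith
  have hlt := intervalIntegral.integral_lt_integral_of_continuousOn_of_le_of_exists_lt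
    (f := J) (g := fun _ => (0:ℝ)) (zero_lt_one) hJc.continuousOn continuousOn_const
    (fun u hu => by
      have := hJle u ⟨hu.1.le, hu.2⟩
      have h2 : 0 ≤ max 0 (δ - g (c u)) * m := by positivity
      linarith)
    ⟨u₀, ⟨hu₀.1, hu₀.2.le⟩, by
      have := hJle u₀ ⟨hu₀.1, hu₀.2.le⟩
      have h2 : g (c u₀) = 0 := by simp [hg, ← hx₀]
      rw [h2, sub_zero, max_eq_right hδpos.le] at this
      nlinarith [mul_pos hδpos hmpos]⟩
  simp only [intervalIntegral.integral_zero] at hlt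
  linarith

/-- Integration by parts: only the normal part of `z` matters. -/
lemma static_normal (c z : ℝ → E2) (hc : ContDiff ℝ 2 c) (hz : ContDiff ℝ 1 z)
    (hcper : ∀ u, c (u + 1) = c u) (hzper : ∀ u, z (u + 1) = z u)
    (hreg : ∀ u, deriv c u ≠ 0) (hinj : Set.InjOn c (Set.Ico (0:ℝ) 1))
    (hint : ∀ φ : E2 → ℝ, ContDiff ℝ 1 φ → (∀ x, 0 ≤ φ x) → HasCompactSupport φ →
      0 ≤ ∫ u in (0:ℝ)..1, (fderiv ℝ φ (c u) (z u) * ‖deriv c u‖ +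
        φ (c u) * ⟪‖deriv c u‖⁻¹ • deriv c u, deriv z u⟫)) :
    ∀ u, z u = ⟪z u, ‖deriv c u‖⁻¹ • deriv c u⟫ • (‖deriv c u‖⁻¹ • deriv c u) := by
  have hdc : ContDiff ℝ 1 (deriv c) := by
    have := (contDiff_succ_iff_deriv (n := 1) (f := c) (𝕜 := ℝ)).1
      (by simpa [one_add_one_eq_two] using hc)
    exact this.2.2
  have hdper : ∀ u, deriv c (u + 1) = deriv c u := by
    intro u
    rw [← deriv_comp_add_const]
    congr 1
    exact funext hcper
  set T : ℝ → E2 := fun u => ‖deriv c u‖⁻¹ • deriv c u with hT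
  have hnpos : ∀ u, 0 < ‖deriv c u‖ := fun u => norm_pos_iff.2 (hreg u)
  have hTc : ContDiff ℝ 1 T := ((hdc.norm ℝ hreg).inv fun u => (hnpos u).ne').smul hdc
  have hTT : ∀ u, ⟪T u, T u⟫ = 1 := by
    intro u
    rw [real_inner_self_eq_norm_sq]
    simp [hT, norm_smul, inv_mul_cancel₀ (hnpos u).ne']
  have hcT : ∀ u, deriv c u = ‖deriv c u‖ • T u := by
    intro u
    simp only [hT, smul_smul]
    rw [mul_inv_cancel₀ (hnpos u).ne', one_smul]
  have hTper : ∀ u, T (u + 1) = T u := fun u => by simp only [hT, hdper]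
  set a : ℝ → ℝ := fun u => ⟪z u, T u⟫ with ha
  have hac : ContDiff ℝ 1 a := hz.inner ℝ hTc
  set D : ℝ → E2 := fun u => z u - a u • T u with hD
  have hDc : ContDiff ℝ 1 D := hz.sub (hac.smul hTc)
  have hDper : ∀ u, D (u + 1) = D u := fun u => by simp only [hD, ha, hTper, hzper]
  have hdT : ∀ u, HasDerivAt T (deriv T u) u :=
    fun u => ((hTc.differentiable (by norm_num)) u).hasDerivAt
  have hda : ∀ u, HasDerivAt a (deriv a u) u :=
    fun u => ((hac.differentiable (by norm_num)) u).hasDerivAt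
  have hdz : ∀ u, HasDerivAt z (deriv z u) u :=
    fun u => ((hz.differentiable (by norm_num)) u).hasDerivAt
  have hTdT : ∀ u, ⟪T u, deriv T u⟫ = 0 := by
    intro u
    have h1 := (hdT u).inner ℝ (hdT u)
    have h2 : (fun u => ⟪T u, T u⟫) = fun _ => (1:ℝ) := funext hTT
    rw [h2] at h1
    have h3 := h1.unique (hasDerivAt_const u (1:ℝ))
    rw [real_inner_comm (deriv T u) (T u)] at h3
    linarith [real_inner_comm (deriv T u) (T u)]
  have hTdz : ∀ u, ⟪T u, deriv z u⟫ = ⟪T u, deriv D u⟫ + deriv a u := by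
    intro u
    have h1 : deriv D u = deriv z u - (a u • deriv T u + deriv a u • T u) :=
      ((hdz u).sub ((hda u).smul (hdT u))).deriv
    rw [h1, inner_sub_right, inner_add_right, real_inner_smul_right, real_inner_smul_right,
      hTdT, hTT]
    ring
  have hcore : ∀ u₀ ∈ Set.Ico (0:ℝ) 1, D u₀ = 0 := by
    refine static_core c D (fun u => ⟪T u, deriv D u⟫) hc hDc.continuous
      (hTc.continuous.inner (hDc.continuous_deriv (by norm_num)))
      (by simpa using hcper 0) (by simpa using hdper 0) (by simpa using hDper 0) hreg hinj ?_ ?_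
    · intro u
      rw [hcT u, real_inner_smul_left]
      simp only [hD]
      rw [inner_sub_right, real_inner_smul_right, hTT, real_inner_comm]
      simp [ha]
    · intro φ hφ hφn hφs
      refine (hint φ hφ hφn hφs).trans_eq ?_
      have hcc := hc.continuous
      have hdcc := hdc.continuous
      have hφc := hφ.continuous
      have hTcc := hTc.continuous
      have hdDc := hDc.continuous_deriv (by norm_num)
      have hdac := hac.continuous_deriv (by norm_num)
      have hDcc := hDc.continuous
      have hacc := hac.continuous
      have hfd : Continuous (fun u => fderiv ℝ φ (c u)) :=
        (hφ.continuous_fderiv (by norm_num)).comp hcc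
      have hbp : ∀ u, HasDerivAt (fun u => φ (c u) * a u)
          (fderiv ℝ φ (c u) (deriv c u) * a u + φ (c u) * deriv a u) u := by
        intro u
        have h1 : HasDerivAt (fun u => φ (c u)) (fderiv ℝ φ (c u) (deriv c u)) u :=
          ((hφ.differentiable (by norm_num)) (c u)).hasFDerivAt.comp_hasDerivAt u
            ((hc.differentiable (by norm_num)) u).hasDerivAt
        exact h1.mul (hda u)
      have hcont : Continuous fun u =>
          (fderiv ℝ φ (c u) (deriv c u) * a u + φ (c u) * deriv a u) := by
        have := hfd.clm_apply hdcc
        fun_prop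
      have hzero : ∫ u in (0:ℝ)..1,
          (fderiv ℝ φ (c u) (deriv c u) * a u + φ (c u) * deriv a u) = 0 := by
        rw [intervalIntegral.integral_eq_sub_of_hasDerivAt (fun u _ => hbp u)
          (hcont.intervalIntegrable _ _)]
        have h1 : c 1 = c 0 := by simpa using hcper 0
        have h2 : a 1 = a 0 := by
          have h3 : z 1 = z 0 := by simpa using hzper 0
          have h4 : T 1 = T 0 := by simpa using hTper 0
          simp only [ha, h3, h4]
        rw [h1, h2, sub_self]
      have hcont2 : Continuous fun u =>
          (fderiv ℝ φ (c u) (D u) * ‖deriv c u‖ + φ (c u) * ⟪T u, deriv D u⟫) := by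
        have := hfd.clm_apply hDcc
        fun_prop
      have hsplit := intervalIntegral.integral_add (hcont2.intervalIntegrable 0 1)
        (hcont.intervalIntegrable (μ := MeasureTheory.volume) 0 1)
      rw [hzero, add_zero] at hsplit
      rw [← hsplit]
      congr 1
      funext u
      have h1 : z u = D u + a u • T u := by simp [hD]
      have h2 : fderiv ℝ φ (c u) (deriv c u) = ‖deriv c u‖ * fderiv ℝ φ (c u) (T u) := by
        conv_lhs => rw [hcT u]
        rw [map_smul, smul_eq_mul]
      rw [hTdz, h2]
      conv_lhs => rw [h1]
      rw [map_add, map_smul, smul_eq_mul]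
      ring
  intro u
  obtain ⟨y, hy, hyu⟩ := Function.Periodic.exists_mem_Ico₀ (f := D) (c := 1) hDper one_pos u
  have : D u = 0 := by rw [hyu]; exact hcore y hy
  exact sub_eq_zero.1 this

lemma param_continuousOn (I : Set ℝ) (B : ℝ → ℝ → ℝ)
    (hB : ContinuousOn (fun p : ℝ × ℝ => B p.1 p.2) (Set.univ ×ˢ I)) :
    ContinuousOn (fun t => ∫ u in (0:ℝ)..1, B u t) I := by
  rw [continuousOn_iff_continuous_domRestrict]
  refine intervalIntegral.continuous_parametric_intervalIntegral_of_continuous'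
    (f := fun (t : I) u => B u t) ?_ 0 1
  have : Continuous fun q : I × ℝ => ((q.2, (q.1 : ℝ)) : ℝ × ℝ) := by fun_prop
  exact hB.comp_continuous this (fun q => ⟨trivial, q.1.2⟩)

lemma param_hasDerivAt (I : Set ℝ) (hI : IsOpen I) (G G' : ℝ → ℝ → ℝ)
    (hd : ∀ u, ∀ t ∈ I, HasDerivAt (fun t => G u t) (G' u t) t)
    (hG : ContinuousOn (fun p : ℝ × ℝ => G p.1 p.2) (Set.univ ×ˢ I))
    (hG' : ContinuousOn (fun p : ℝ × ℝ => G' p.1 p.2) (Set.univ ×ˢ I)) (t₀ : ℝ) (ht₀ : t₀ ∈ I) :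
    HasDerivAt (fun t => ∫ u in (0:ℝ)..1, G u t) (∫ u in (0:ℝ)..1, G' u t₀) t₀ := by
  obtain ⟨ε, hε, hsub⟩ := Metric.nhds_basis_closedBall.mem_iff.1 (hI.mem_nhds ht₀)
  have hslice : ∀ (H : ℝ → ℝ → ℝ), ContinuousOn (fun p : ℝ × ℝ => H p.1 p.2) (Set.univ ×ˢ I) →
      ∀ t ∈ I, Continuous (fun u => H u t) := fun H hH t ht =>
    hH.comp_continuous (f := fun u : ℝ => (u, t)) (by fun_prop) (fun u => ⟨trivial, ht⟩)
  obtain ⟨C, hC⟩ := ((isCompact_Icc (a := (0:ℝ)) (b := 1)).prod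
    (isCompact_closedBall t₀ ε)).exists_bound_of_continuousOn
    (hG'.mono (Set.prod_mono (Set.subset_univ _) hsub))
  refine (intervalIntegral.hasDerivAt_integral_of_dominated_loc_of_deriv_le
    (F := fun t u => G u t) (F' := fun t u => G' u t) (bound := fun _ => C)
    (s := Metric.closedBall t₀ ε) (Metric.closedBall_mem_nhds t₀ hε) ?_ ?_ ?_ ?_ ?_ ?_).2
  · filter_upwards [hI.mem_nhds ht₀] with t ht
    exact (hslice G hG t ht).aestronglyMeasurable
  · exact (hslice G hG t₀ ht₀).intervalIntegrable _ _
  · exact (hslice G' hG' t₀ ht₀).aestronglyMeasurable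
  · refine Filter.Eventually.of_forall fun u hu t ht => ?_
    rw [Set.uIoc_of_le zero_le_one] at hu
    exact hC (u, t) ⟨⟨hu.1.le, hu.2⟩, ht⟩
  · simp
  · exact Filter.Eventually.of_forall fun u _ t ht => hd u t (hsub ht)


lemma du_hasDerivAt (γ : ℝ → ℝ → E2) (hγ : ContDiff ℝ (⊤ : ℕ∞) (fun p : ℝ × ℝ => γ p.1 p.2))
    (u t : ℝ) : HasDerivAt (fun u' => γ u' t)
      (fderiv ℝ (fun p : ℝ × ℝ => γ p.1 p.2) (u, t) (1, 0)) u :=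
  HasFDerivAt.comp_hasDerivAt (f := fun u' : ℝ => (u', t)) u
    ((hγ.differentiable (by simp)) (u, t)).hasFDerivAt
    ((hasDerivAt_id' u).prodMk (hasDerivAt_const u t))

lemma dt_hasDerivAt (γ : ℝ → ℝ → E2) (hγ : ContDiff ℝ (⊤ : ℕ∞) (fun p : ℝ × ℝ => γ p.1 p.2))
    (u t : ℝ) : HasDerivAt (fun t' => γ u t')
      (fderiv ℝ (fun p : ℝ × ℝ => γ p.1 p.2) (u, t) (0, 1)) t :=
  HasFDerivAt.comp_hasDerivAt (f := fun t' : ℝ => (u, t')) t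
    ((hγ.differentiable (by simp)) (u, t)).hasFDerivAt
    ((hasDerivAt_const t u).prodMk (hasDerivAt_id' t))

lemma du_eq (γ : ℝ → ℝ → E2) (hγ : ContDiff ℝ (⊤ : ℕ∞) (fun p : ℝ × ℝ => γ p.1 p.2))
    (u t : ℝ) : du γ u t = fderiv ℝ (fun p : ℝ × ℝ => γ p.1 p.2) (u, t) (1, 0) :=
  (du_hasDerivAt γ hγ u t).deriv

lemma dt_eq (γ : ℝ → ℝ → E2) (hγ : ContDiff ℝ (⊤ : ℕ∞) (fun p : ℝ × ℝ => γ p.1 p.2))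
    (u t : ℝ) : dtγ γ u t = fderiv ℝ (fun p : ℝ × ℝ => γ p.1 p.2) (u, t) (0, 1) :=
  (dt_hasDerivAt γ hγ u t).deriv

lemma du_contDiff (γ : ℝ → ℝ → E2) (hγ : ContDiff ℝ (⊤ : ℕ∞) (fun p : ℝ × ℝ => γ p.1 p.2)) :
    ContDiff ℝ (⊤ : ℕ∞) (fun p : ℝ × ℝ => du γ p.1 p.2) := by
  simp only [du_eq γ hγ]
  exact (hγ.fderiv_right (m := (⊤ : ℕ∞)) (by simp)).clm_apply contDiff_const

lemma dt_contDiff (γ : ℝ → ℝ → E2) (hγ : ContDiff ℝ (⊤ : ℕ∞) (fun p : ℝ × ℝ => γ p.1 p.2)) :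
    ContDiff ℝ (⊤ : ℕ∞) (fun p : ℝ × ℝ => dtγ γ p.1 p.2) := by
  simp only [dt_eq γ hγ]
  exact (hγ.fderiv_right (m := (⊤ : ℕ∞)) (by simp)).clm_apply contDiff_const

lemma dt_du_comm (γ : ℝ → ℝ → E2) (hγ : ContDiff ℝ (⊤ : ℕ∞) (fun p : ℝ × ℝ => γ p.1 p.2))
    (u t : ℝ) : dtγ (du γ) u t = du (dtγ γ) u t := by
  rw [dt_eq _ (du_contDiff γ hγ), du_eq _ (dt_contDiff γ hγ)]
  simp only [du_eq γ hγ, dt_eq γ hγ]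
  have h2 : DifferentiableAt ℝ (fderiv ℝ (fun p : ℝ × ℝ => γ p.1 p.2)) (u, t) :=
    ((hγ.fderiv_right (m := (⊤ : ℕ∞)) (by simp)).differentiable (by simp)) _
  have h3 : ∀ v : ℝ × ℝ, fderiv ℝ (fun p : ℝ × ℝ => fderiv ℝ (fun p : ℝ × ℝ => γ p.1 p.2) p v)
      (u, t) = (fderiv ℝ (fderiv ℝ (fun p : ℝ × ℝ => γ p.1 p.2)) (u, t)).flip v := by
    intro v
    rw [fderiv_clm_apply h2 (differentiableAt_const v)]
    simp
  have hs : IsSymmSndFDerivAt ℝ (fun p : ℝ × ℝ => γ p.1 p.2) (u, t) :=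
    hγ.contDiffAt.isSymmSndFDerivAt (by simp; exact WithTop.coe_le_coe.2 (le_top : (2 : ℕ∞) ≤ ⊤))
  simp only [h3, ContinuousLinearMap.flip_apply]
  exact hs _ _

lemma hasDerivAt_norm_of_ne {f : ℝ → E2} {f' : E2} {t : ℝ} (hf : HasDerivAt f f' t)
    (h0 : f t ≠ 0) : HasDerivAt (fun s => ‖f s‖) ⟪‖f t‖⁻¹ • f t, f'⟫ t := by
  have hp : 0 < ‖f t‖ := norm_pos_iff.2 h0
  have h1 := (hf.norm_sq).sqrt (by positivity)
  simp only [Real.sqrt_sq (norm_nonneg _)] at h1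
  convert h1 using 1
  rw [real_inner_smul_left]
  field_simp

/-- Section 2.3: if a smooth normal vector field `w` along a smooth family of embedded
closed curves satisfies Brakke's inequality (2.9) in its time-integrated form for all
nonnegative compactly supported test functions, then `w` equals the normal velocity. -/
theorem brakke_inequality_characterizes_normal_velocity
    (I : Set ℝ) (hI : IsOpen I) (hIconn : IsPreconnected I)
    (γ w : ℝ → ℝ → EuclideanSpace ℝ (Fin 2))
    (hγ : ContDiff ℝ (⊤ : ℕ∞) (fun p : ℝ × ℝ => γ p.1 p.2))
    (hγper : ∀ u t, γ (u + 1) t = γ u t)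
    (hreg : ∀ (u : ℝ), ∀ t ∈ I, du γ u t ≠ 0)
    (hemb : ∀ t ∈ I, Set.InjOn (fun u => γ u t) (Set.Ico (0:ℝ) 1))
    (hw : ContDiff ℝ (⊤ : ℕ∞) (fun p : ℝ × ℝ => w p.1 p.2))
    (hwper : ∀ u t, w (u + 1) t = w u t)
    (hwnormal : ∀ (u : ℝ), ∀ t ∈ I, ⟪w u t, tang γ u t⟫ = 0)
    (hbrakke : ∀ φ : EuclideanSpace ℝ (Fin 2) → ℝ → ℝ,
      ContDiff ℝ 1 (fun p : EuclideanSpace ℝ (Fin 2) × ℝ => φ p.1 p.2) →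
      (∀ x t, 0 ≤ φ x t) →
      (∀ t : ℝ, HasCompactSupport (fun x => φ x t)) →
      ∀ t₁ ∈ I, ∀ t₂ ∈ I, t₁ < t₂ →
        (∫ u in (0:ℝ)..1, φ (γ u t₂) t₂ * ‖du γ u t₂‖)
          - (∫ u in (0:ℝ)..1, φ (γ u t₁) t₁ * ‖du γ u t₁‖)
        ≤ ∫ t in t₁..t₂, ∫ u in (0:ℝ)..1,
            (deriv (fun τ => φ (γ u t) τ) t
              + ⟪gradient (fun z => φ z t) (γ u t) - φ (γ u t) t • curv γ u t,
                  w u t⟫) * ‖du γ u t‖) :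
    ∀ (u : ℝ), ∀ t ∈ I, w u t = nvel γ u t := by
  have hdu := du_contDiff γ hγ
  have hdt := dt_contDiff γ hγ
  have hddt := du_contDiff (dtγ γ) hdt
  have hdw := du_contDiff w hw
  have hpos : ∀ (u : ℝ), ∀ t ∈ I, 0 < ‖du γ u t‖ := fun u t ht => norm_pos_iff.2 (hreg u t ht)
  have htang : ContinuousOn (fun p : ℝ × ℝ => tang γ p.1 p.2) (Set.univ ×ˢ I) := by
    have h1 : ContinuousOn (fun p : ℝ × ℝ => ‖du γ p.1 p.2‖⁻¹) (Set.univ ×ˢ I) :=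
      (hdu.continuous.norm.continuousOn).inv₀ fun p hp => (hpos p.1 p.2 hp.2).ne'
    exact h1.smul hdu.continuous.continuousOn
  -- the curvature term
  have hcurv : ∀ (u : ℝ), ∀ t ∈ I, ⟪curv γ u t, w u t⟫ * ‖du γ u t‖ = - ⟪tang γ u t, du w u t⟫ := by
    intro u t ht
    have hs : ContDiff ℝ 1 (fun u' => du γ u' t) :=
      (hdu.comp (f := fun u' : ℝ => (u', t)) (contDiff_id.prodMk contDiff_const)).of_le
        (by exact mod_cast le_top)
    have hTd : HasDerivAt (fun u' => tang γ u' t) (deriv (fun u' => tang γ u' t) u) u := by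
      have : ContDiff ℝ 1 (fun u' => tang γ u' t) :=
        ((hs.norm ℝ fun u' => hreg u' t ht).inv fun u' => (hpos u' t ht).ne').smul hs
      exact ((this.differentiable (by norm_num)) u).hasDerivAt
    have hwd : HasDerivAt (fun u' => w u' t) (du w u t) u := by
      rw [du_eq w hw]; exact du_hasDerivAt w hw u t
    have h1 := hwd.inner ℝ hTd
    have h2 : (fun u' => ⟪w u' t, tang γ u' t⟫) = fun _ => (0:ℝ) :=
      funext fun u' => hwnormal u' t ht
    rw [h2] at h1
    have h3 := h1.unique (hasDerivAt_const u (0:ℝ))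
    have h4 := (hpos u t ht).ne'
    simp only [curv, real_inner_smul_left]
    rw [real_inner_comm] at h3
    rw [real_inner_comm (du w u t) (tang γ u t)]
    field_simp
    linarith
  intro u₁ t₀ ht₀
  have hsγ : ContDiff ℝ (⊤ : ℕ∞) (fun u => γ u t₀) :=
    hγ.comp (f := fun u' : ℝ => (u', t₀)) (contDiff_id.prodMk contDiff_const)
  have hsw : ContDiff ℝ (⊤ : ℕ∞) (fun u => w u t₀) :=
    hw.comp (f := fun u' : ℝ => (u', t₀)) (contDiff_id.prodMk contDiff_const)
  have hsdt : ContDiff ℝ (⊤ : ℕ∞) (fun u => dtγ γ u t₀) :=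
    hdt.comp (f := fun u' : ℝ => (u', t₀)) (contDiff_id.prodMk contDiff_const)
  have hdtper : ∀ u, dtγ γ (u + 1) t₀ = dtγ γ u t₀ := by
    intro u
    simp only [dtγ, hγper]
  have main := static_normal (fun u => γ u t₀) (fun u => w u t₀ - dtγ γ u t₀)
    (hsγ.of_le (by exact WithTop.coe_le_coe.2 (le_top : (2 : ℕ∞) ≤ ⊤))) ((hsw.sub hsdt).of_le (by exact mod_cast le_top))
    (fun u => hγper u t₀) (fun u => by simp only [hwper, hdtper])
    (fun u => hreg u t₀ ht₀) (hemb t₀ ht₀) ?_ u₁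
  · have main : w u₁ t₀ - dtγ γ u₁ t₀ =
        ⟪w u₁ t₀ - dtγ γ u₁ t₀, tang γ u₁ t₀⟫ • tang γ u₁ t₀ := main
    rw [inner_sub_left, hwnormal u₁ t₀ ht₀, zero_sub, neg_smul] at main
    rw [nvel, sub_eq_add_neg, ← main]
    abel
  · intro φ hφ hφn hφs
    have hφc := hφ.continuous
    have hfd := hφ.continuous_fderiv (by norm_num)
    have hφd : ∀ x, HasFDerivAt φ (fderiv ℝ φ x) x :=
      fun x => ((hφ.differentiable (by norm_num)) x).hasFDerivAt
    -- time derivative of the weighted length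
    have hA := param_hasDerivAt I hI (fun u t => φ (γ u t) * ‖du γ u t‖)
      (fun u t => fderiv ℝ φ (γ u t) (dtγ γ u t) * ‖du γ u t‖ +
        φ (γ u t) * ⟪tang γ u t, du (dtγ γ) u t⟫)
      (fun u t ht => by
        have h1 : HasDerivAt (fun t' => γ u t') (dtγ γ u t) t := by
          rw [dt_eq γ hγ]; exact dt_hasDerivAt γ hγ u t
        have h2 : HasDerivAt (fun t' => φ (γ u t')) (fderiv ℝ φ (γ u t) (dtγ γ u t)) t :=
          (hφd (γ u t)).comp_hasDerivAt t h1
        have h3 : HasDerivAt (fun t' => du γ u t') (du (dtγ γ) u t) t := by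
          rw [← dt_du_comm γ hγ, dt_eq _ hdu]; exact dt_hasDerivAt _ hdu u t
        exact h2.mul (hasDerivAt_norm_of_ne h3 (hreg u t ht)))
      ((hφc.comp hγ.continuous).mul hdu.continuous.norm).continuousOn
      ((((hfd.comp hγ.continuous).clm_apply hdt.continuous).mul
        hdu.continuous.norm).continuousOn.add ((hφc.comp hγ.continuous).continuousOn.mul
          (htang.inner hddt.continuous.continuousOn))) t₀ ht₀
    -- the right-hand side
    have hBc : ContinuousOn (fun p : ℝ × ℝ => fderiv ℝ φ (γ p.1 p.2) (w p.1 p.2) * ‖du γ p.1 p.2‖ +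
        φ (γ p.1 p.2) * ⟪tang γ p.1 p.2, du w p.1 p.2⟫) (Set.univ ×ˢ I) :=
      ((((hfd.comp hγ.continuous).clm_apply hw.continuous).mul
        hdu.continuous.norm).continuousOn.add ((hφc.comp hγ.continuous).continuousOn.mul
          (htang.inner hdw.continuous.continuousOn)))
    have hBI := param_continuousOn I (fun u t => fderiv ℝ φ (γ u t) (w u t) * ‖du γ u t‖ +
        φ (γ u t) * ⟪tang γ u t, du w u t⟫) hBc
    set A : ℝ → ℝ := fun t => ∫ u in (0:ℝ)..1, φ (γ u t) * ‖du γ u t‖ with hAdef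
    set B : ℝ → ℝ := fun t => ∫ u in (0:ℝ)..1, (fderiv ℝ φ (γ u t) (w u t) * ‖du γ u t‖ +
        φ (γ u t) * ⟪tang γ u t, du w u t⟫) with hBdef
    have hineq : ∀ t ∈ I, t₀ < t → A t - A t₀ ≤ ∫ s in t₀..t, B s := by
      intro t ht hlt
      refine (hbrakke (fun x _ => φ x) (hφ.comp contDiff_fst) (fun x _ => hφn x)
        (fun _ => hφs) t₀ ht₀ t ht hlt).trans_eq ?_
      refine intervalIntegral.integral_congr fun s hs => ?_
      have hsI : s ∈ I := hIconn.ordConnected.uIcc_subset ht₀ ht hs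
      refine intervalIntegral.integral_congr fun u _ => ?_
      have hgr : ⟪gradient φ (γ u s), w u s⟫ = fderiv ℝ φ (γ u s) (w u s) := by
        simp [gradient]
      have h1 := hcurv u s hsI
      simp only [deriv_const, zero_add, inner_sub_left, real_inner_smul_left]
      have hgr' : ⟪gradient (fun z => φ z) (γ u s), w u s⟫ = fderiv ℝ φ (γ u s) (w u s) := hgr
      rw [hgr', sub_mul, mul_assoc, h1]
      ring
    have hBat : ContinuousAt B t₀ := hBI.continuousAt (hI.mem_nhds ht₀)
    have hBder : HasDerivAt (fun t => ∫ s in t₀..t, B s) (B t₀) t₀ :=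
      intervalIntegral.integral_hasDerivAt_right (by simp)
        (hBI.stronglyMeasurableAtFilter hI t₀ ht₀) hBat
    have hH := hBder.sub hA
    have hnn := ge_of_tendsto (b := 0) ((hasDerivWithinAt_iff_tendsto_slope'
      Set.self_notMem_Ioi).1 (hH.hasDerivWithinAt (s := Set.Ioi t₀))) (by
        filter_upwards [self_mem_nhdsWithin, mem_nhdsWithin_of_mem_nhds (hI.mem_nhds ht₀)]
          with t ht htI
        have ht : t₀ < t := ht
        have h1 := hineq t htI ht
        rw [slope_def_field]
        refine div_nonneg ?_ (sub_nonneg.2 ht.le)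
        simp only [Pi.sub_apply, intervalIntegral.integral_same]
        linarith)
    have hslice : ∀ (H : ℝ × ℝ → ℝ), ContinuousOn H (Set.univ ×ˢ I) →
        Continuous (fun u => H (u, t₀)) := fun H hH =>
      hH.comp_continuous (f := fun u : ℝ => (u, t₀)) (by fun_prop) (fun u => ⟨trivial, ht₀⟩)
    have hc1 := hslice _ hBc
    have hc2 := hslice _ ((((hfd.comp hγ.continuous).clm_apply hdt.continuous).mul
        hdu.continuous.norm).continuousOn.add ((hφc.comp hγ.continuous).continuousOn.mul
          (htang.inner hddt.continuous.continuousOn)))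
    refine hnn.trans_eq ?_
    simp only [hBdef]
    refine (intervalIntegral.integral_sub (hc1.intervalIntegrable 0 1)
      (hc2.intervalIntegrable (μ := MeasureTheory.volume) 0 1)).symm.trans ?_
    refine intervalIntegral.integral_congr fun u _ => ?_
    have hwd : HasDerivAt (fun u' => w u' t₀) (du w u t₀) u := by
      rw [du_eq w hw]; exact du_hasDerivAt w hw u t₀
    have hzd : HasDerivAt (fun u' => dtγ γ u' t₀) (du (dtγ γ) u t₀) u := by
      rw [du_eq _ hdt]; exact du_hasDerivAt _ hdt u t₀
    have hd : deriv (fun u' => w u' t₀ - dtγ γ u' t₀) u = du w u t₀ - du (dtγ γ) u t₀ :=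
      (hwd.sub hzd).deriv
    have hT : ‖deriv (fun u' => γ u' t₀) u‖⁻¹ • deriv (fun u' => γ u' t₀) u = tang γ u t₀ := rfl
    have hU : deriv (fun u' => γ u' t₀) u = du γ u t₀ := rfl
    simp only [hd, hT, map_sub, inner_sub_right, Function.comp_apply, Pi.add_apply, Pi.mul_apply]
    rw [hU]
    ring
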